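/- Let μ be meromorphic and nonconstant on all of ℂ, admitting an algebraic addition theorem: there is a nonzero polynomial G ∈ ℂ[X,Y,Z] with G(μ(u), μ(v), μ(u+v)) = 0 for all u, v ∈ ℂ at which μ(u), μ(v) and μ(u+v) are all analytic. Let r > 0 and let φ be analytic on the disk D(0,r) = {u : |u| < r}, and suppose there is a polynomial H ∈ ℂ[X,Y] of positive degree in X such that H(φ(u), μ(u)) = 0 for all u ∈ D(0,r) at which μ is analytic. Then φ admits an algebraic addition theorem: there exists a nonzero polynomial g ∈ ℂ[X,Y,Z] such that g(φ(u), φ(v), φ(u+v)) = 0 for all u, v with |u| < r/2 and |v| < r/2. -/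

import Mathlib

open Metric

section algebraic

open AlgebraicIndependent Set

theorem AlgebraicIndependent.matroid_indep_range_iff {R A ι : Type*} [CommRing R] [CommRing A]
    [Algebra R A] [FaithfulSMul R A] [NoZeroDivisors A] {x : ι → A} (hx : Function.Injective x) :
    (matroid R A).Indep (range x) ↔ AlgebraicIndependent R x :=
  algebraicIndependent_subtype_range hx

theorem AlgebraicIndependent.mem_closure_singleton_of_not_pair {R A : Type*} [CommRing R]
    [CommRing A] [Algebra R A] [FaithfulSMul R A] [NoZeroDivisors A] {a b : A}
    (ha : Transcendental R a) (hab : ¬ AlgebraicIndependent R ![b, a]) :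
    b ∈ (matroid R A).closure {a} := by
  have ha' : (matroid R A).Indep {a} := by
    change AlgebraicIndependent R (fun x : ({a} : Set A) ↦ (x : A))
    rw [algebraicIndependent_unique_type_iff]
    exact ha
  rw [ha'.mem_closure_iff]
  by_cases h : b = a
  · exact Or.inr h
  · left
    rw [← Matroid.not_indep_iff]
    have hinj : Function.Injective ![b, a] := by
      intro i j hij
      fin_cases i <;> fin_cases j <;> simp_all [eq_comm]
    rw [← matroid_indep_range_iff hinj, Matrix.range_cons_cons_empty] at hab
    exact hab

theorem AlgebraicIndependent.of_forall_mem_closure {R A ι : Type*} [CommRing R] [CommRing A]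
    [Algebra R A] [FaithfulSMul R A] [IsDomain A] [Finite ι] {a b : ι → A}
    (hba : ∀ i, b i ∈ (matroid R A).closure {a i}) (hb : AlgebraicIndependent R b) :
    AlgebraicIndependent R a := by
  have : Nontrivial R := (algebraMap R A).domain_nontrivial
  have hsub : range b ⊆ (matroid R A).closure (range a) := by
    rintro _ ⟨i, rfl⟩
    exact (matroid R A).closure_subset_closure (singleton_subset_iff.2 (mem_range_self i)) (hba i)
  have hle : ENat.card ι ≤ (matroid R A).eRk (range a) := by
    have h := (matroid R A).eRk_mono hsub
    rwa [Matroid.eRk_closure_eq, ((matroid_indep_range_iff hb.injective).2 hb).eRk_eq_encard,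
      ← image_univ, hb.injective.encard_image, encard_univ] at h
  have hcard : (range a).encard ≤ ENat.card ι := by
    rw [← image_univ, ← encard_univ]
    exact encard_image_le _ _
  have hinj : Function.Injective a := by
    rw [← injOn_univ]
    refine finite_univ.injOn_of_encard_image_eq (le_antisymm (encard_image_le _ _) ?_)
    rw [image_univ, encard_univ]
    exact hle.trans (Matroid.eRk_le_encard _ _)
  rw [← matroid_indep_range_iff hinj, Matroid.indep_iff_eRk_eq_encard_of_finite (finite_range a)]
  exact le_antisymm (Matroid.eRk_le_encard _ _) (hcard.trans hle)

theorem IsAlgebraic.mem_range_algebraMap_of_isAlgClosed {k A : Type*} [Field k] [IsAlgClosed k]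
    [CommRing A] [IsDomain A] [Algebra k A] {a : A} (ha : IsAlgebraic k a) :
    a ∈ range (algebraMap k A) :=
  minpoly.mem_range_of_degree_eq_one k a
    (IsAlgClosed.degree_eq_one_of_irreducible k (minpoly.irreducible ha.isIntegral))

end algebraic

section analytic

open Set Topology

variable {E : Type*} [NormedAddCommGroup E] [NormedSpace ℂ E]

/-- The algebra of analytic functions on `U`, as functions on the subtype. -/
def analyticSubalgebra (U : Set E) : Subalgebra ℂ (U → ℂ) where
  carrier := {f | ∃ F : E → ℂ, AnalyticOnNhd ℂ F U ∧ U.domRestrict F = f}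
  mul_mem' := by
    rintro _ _ ⟨F, hF, rfl⟩ ⟨G, hG, rfl⟩
    exact ⟨F * G, hF.mul hG, rfl⟩
  add_mem' := by
    rintro _ _ ⟨F, hF, rfl⟩ ⟨G, hG, rfl⟩
    exact ⟨F + G, hF.add hG, rfl⟩
  algebraMap_mem' c := ⟨fun _ ↦ c, analyticOnNhd_const, rfl⟩

namespace analyticSubalgebra

/-- An analytic function on `U` as an element of `analyticSubalgebra U`. -/
def mk {U : Set E} (F : E → ℂ) (hF : AnalyticOnNhd ℂ F U) : analyticSubalgebra U :=
  ⟨U.domRestrict F, F, hF, rfl⟩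

theorem exists_eq_mk {U : Set E} (f : analyticSubalgebra U) : ∃ F hF, f = mk F hF := by
  obtain ⟨_, F, hF, rfl⟩ := f
  exact ⟨F, hF, rfl⟩

theorem mk_eq_zero_iff {U : Set E} {F : E → ℂ} {hF : AnalyticOnNhd ℂ F U} :
    mk F hF = 0 ↔ EqOn F 0 U := by
  rw [Subtype.ext_iff, funext_iff, Subtype.forall]
  rfl

theorem noZeroDivisors {U : Set E} (hU : IsOpen U) (hUc : IsPreconnected U) :
    NoZeroDivisors (analyticSubalgebra U) where
  eq_zero_or_eq_zero_of_mul_eq_zero {f g} hfg := by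
    obtain ⟨F, hF, rfl⟩ := exists_eq_mk f
    obtain ⟨G, hG, rfl⟩ := exists_eq_mk g
    have hFG : ∀ x ∈ U, F x * G x = 0 := fun x hx ↦ congrFun (congrArg Subtype.val hfg) ⟨x, hx⟩
    rw [mk_eq_zero_iff, mk_eq_zero_iff, or_iff_not_imp_left]
    intro hF0
    obtain ⟨x, hx, hFx⟩ : ∃ x ∈ U, F x ≠ 0 := by simpa [EqOn] using hF0
    refine hG.eqOn_zero_of_preconnected_of_eventuallyEq_zero hUc hx ?_
    filter_upwards [(hF x hx).continuousAt.eventually_ne hFx, hU.mem_nhds hx] with y hy hyU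
    exact (mul_eq_zero.1 (hFG y hyU)).resolve_left hy

theorem isDomain {U : Set E} (hU : IsOpen U) (hUc : IsConnected U) :
    IsDomain (analyticSubalgebra U) := by
  have := noZeroDivisors hU hUc.isPreconnected
  have := hUc.nonempty.to_subtype
  exact NoZeroDivisors.to_isDomain _

theorem aeval_apply {U : Set E} {σ : Type*} (p : MvPolynomial σ ℂ)
    (f : σ → analyticSubalgebra U) (x : U) :
    (MvPolynomial.aeval f p : analyticSubalgebra U).1 x =
      MvPolynomial.eval (fun i ↦ (f i).1 x) p := by
  let ev : analyticSubalgebra U →ₐ[ℂ] ℂ :=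
    (Pi.evalAlgHom ℂ (fun _ : U ↦ ℂ) x).comp (analyticSubalgebra U).val
  change ev _ = _
  rw [← MvPolynomial.aeval_eq_eval]
  exact (MvPolynomial.comp_aeval_apply (φ := ev) f p)

/-- An analytic function on a connected open set is algebraic over `ℂ` only if it is constant. -/
theorem transcendental_mk {U : Set E} (hU : IsOpen U) (hUc : IsConnected U) {F : E → ℂ}
    {hF : AnalyticOnNhd ℂ F U} (h : ¬ ∃ c, ∀ x ∈ U, F x = c) : Transcendental ℂ (mk F hF) := by
  have := isDomain hU hUc
  intro ha
  obtain ⟨c, hc⟩ := ha.mem_range_algebraMap_of_isAlgClosed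
  exact h ⟨c, fun x hx ↦ (congrFun (congrArg Subtype.val hc) ⟨x, hx⟩).symm⟩

end analyticSubalgebra

/-- A meromorphic function on `ℂ` that is constant near one point is constant where analytic. -/
theorem MeromorphicOn.eq_const_of_eventually {f : ℂ → ℂ} (hf : MeromorphicOn f univ) {c z : ℂ}
    (hz : ∀ᶠ w in 𝓝 z, f w = c) {u : ℂ} (hu : AnalyticAt ℂ f u) : f u = c := by
  have hfc : MeromorphicOn (fun w ↦ f w - c) univ :=
    hf.sub fun _ _ ↦ MeromorphicAt.const c _
  have htop : meromorphicOrderAt (fun w ↦ f w - c) u = ⊤ := by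
    by_contra hne
    refine (hfc.exists_meromorphicOrderAt_ne_top_iff_forall_mem isConnected_univ).1
      ⟨u, mem_univ u, hne⟩ z (mem_univ z) ?_
    rw [meromorphicOrderAt_eq_top_iff]
    exact (hz.mono fun w hw ↦ sub_eq_zero.2 hw).filter_mono nhdsWithin_le_nhds
  rw [meromorphicOrderAt_eq_top_iff] at htop
  have h := (AnalyticAt.frequently_zero_iff_eventually_zero
    (hu.sub analyticAt_const)).1 htop.frequently
  exact sub_eq_zero.1 h.self_of_nhds

end analytic

open Set Filter Topology

/-- **The 'if' direction of Weierstrass' second theorem.**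
Let `μ` be meromorphic and nonconstant on `ℂ`, admitting an algebraic addition theorem
`G (μ u, μ v, μ (u+v)) = 0` (with `G ≠ 0`) wherever `μ` is analytic at `u`, `v` and
`u + v`.  If `φ` is analytic on the disk `|u| < r` and is a root of an algebraic equation
`H (φ u, μ u) = 0` (`H` of positive degree in its first variable) on that disk, then `φ`
admits an algebraic addition theorem on the bidisk `|u|, |v| < r/2`. -/
theorem root_over_meromorphic_AAT_admits_AAT (μ : ℂ → ℂ)
    (hμ : MeromorphicOn μ (Set.univ : Set ℂ))
    (hμnc : ¬ ∃ c : ℂ, ∀ u : ℂ, AnalyticAt ℂ μ u → μ u = c)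
    (G : MvPolynomial (Fin 3) ℂ) (hG : G ≠ 0)
    (hAAT : ∀ u v : ℂ, AnalyticAt ℂ μ u → AnalyticAt ℂ μ v → AnalyticAt ℂ μ (u + v) →
      MvPolynomial.eval ![μ u, μ v, μ (u + v)] G = 0)
    (r : ℝ) (hr : 0 < r) (φ : ℂ → ℂ)
    (hφ : AnalyticOnNhd ℂ φ (ball (0 : ℂ) r))
    (H : MvPolynomial (Fin 2) ℂ) (hHdeg : 0 < H.degreeOf 0)
    (hH : ∀ u ∈ ball (0 : ℂ) r, AnalyticAt ℂ μ u →
      MvPolynomial.eval ![φ u, μ u] H = 0) :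
    ∃ g : MvPolynomial (Fin 3) ℂ, g ≠ 0 ∧
      ∀ u v : ℂ, ‖u‖ < r / 2 → ‖v‖ < r / 2 →
        MvPolynomial.eval ![φ u, φ v, φ (u + v)] g = 0 := by
  let L : Fin 3 → ℂ × ℂ →L[ℂ] ℂ := ![.fst ℂ ℂ ℂ, .snd ℂ ℂ ℂ, .fst ℂ ℂ ℂ + .snd ℂ ℂ ℂ]
  have hL (f : ℂ → ℂ) (p : ℂ × ℂ) : (fun i ↦ f (L i p)) = ![f p.1, f p.2, f (p.1 + p.2)] := by
    ext i; fin_cases i <;> rfl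
  have hLsurj (i : Fin 3) : Function.Surjective (L i) := by
    intro z
    fin_cases i
    · exact ⟨(z, 0), rfl⟩
    · exact ⟨(0, z), rfl⟩
    · exact ⟨(z, 0), add_zero z⟩
  -- a base point on the diagonal of the bidisk around which everything is analytic
  obtain ⟨t, ht, htt, htr⟩ : ∃ t, AnalyticAt ℂ μ t ∧ AnalyticAt ℂ μ (t + t) ∧
      t ∈ ball (0 : ℂ) (r / 2) := by
    have h0 : ∀ᶠ z in 𝓝[≠] (0 : ℂ), AnalyticAt ℂ μ z := (hμ 0 (mem_univ 0)).eventually_analyticAt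
    have hadd : Tendsto (fun z : ℂ ↦ z + z) (𝓝[≠] 0) (𝓝[≠] 0) := by
      refine tendsto_nhdsWithin_of_tendsto_nhds_of_eventually_within _ ?_ ?_
      · refine Tendsto.mono_left ?_ nhdsWithin_le_nhds
        simpa using (show Continuous fun z : ℂ ↦ z + z by fun_prop).tendsto 0
      · filter_upwards [self_mem_nhdsWithin] with z hz
        simpa using hz
    exact (h0.and ((hadd.eventually h0).and
      (mem_nhdsWithin_of_mem_nhds (ball_mem_nhds 0 (half_pos hr))))).exists
  let S : Set (ℂ × ℂ) := {p | ∀ i, AnalyticAt ℂ μ (L i p) ∧ L i p ∈ ball (0 : ℂ) r}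
  have hS : IsOpen S := by
    simp only [S, ofPred_forall]
    exact isOpen_iInter_of_finite fun i ↦
      ((isOpen_analyticAt ℂ μ).inter isOpen_ball).preimage (L i).continuous
  have hLball {p : ℂ × ℂ} (hp : p ∈ ball (0 : ℂ) (r / 2) ×ˢ ball (0 : ℂ) (r / 2)) (i : Fin 3) :
      L i p ∈ ball (0 : ℂ) r := by
    obtain ⟨h1, h2⟩ := hp
    rw [mem_ball_zero_iff] at h1 h2 ⊢
    have h3 : ‖p.1 + p.2‖ ≤ ‖p.1‖ + ‖p.2‖ := norm_add_le _ _
    fin_cases i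
    · change ‖p.1‖ < r; linarith
    · change ‖p.2‖ < r; linarith
    · change ‖p.1 + p.2‖ < r; linarith
  have htS : (t, t) ∈ S := fun i ↦ ⟨by fin_cases i; exacts [ht, ht, htt], hLball ⟨htr, htr⟩ i⟩
  obtain ⟨ε, hε, hεS⟩ := Metric.isOpen_iff.1 hS _ htS
  set U := ball (t, t) ε
  have hUc : IsConnected U := ⟨nonempty_ball.2 hε, (convex_ball _ _).isPreconnected⟩
  have := analyticSubalgebra.isDomain isOpen_ball hUc
  have : FaithfulSMul ℂ (analyticSubalgebra U) :=
    (faithfulSMul_iff_algebraMap_injective _ _).2 (algebraMap ℂ _).injective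
  let a (i : Fin 3) : analyticSubalgebra U := analyticSubalgebra.mk (fun p ↦ μ (L i p))
    fun p hp ↦ (hεS hp i).1.comp ((L i).analyticAt p)
  let b (i : Fin 3) : analyticSubalgebra U := analyticSubalgebra.mk (fun p ↦ φ (L i p))
    fun p hp ↦ (hφ _ (hεS hp i).2).comp ((L i).analyticAt p)
  have ha (i : Fin 3) : Transcendental ℂ (a i) := by
    refine analyticSubalgebra.transcendental_mk isOpen_ball hUc fun ⟨c, hc⟩ ↦
      hμnc ⟨c, fun u hu ↦ ?_⟩
    refine hμ.eq_const_of_eventually (z := L i (t, t)) ?_ hu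
    filter_upwards [((L i).isOpenMap (hLsurj i)).image_mem_nhds (ball_mem_nhds (t, t) hε)]
    rintro _ ⟨p, hp, rfl⟩
    exact hc p hp
  have hba (i : Fin 3) : ¬ AlgebraicIndependent ℂ ![b i, a i] := by
    refine fun h ↦ hHdeg.ne' ?_
    rw [(algebraicIndependent_iff.1 h) H ?_, MvPolynomial.degreeOf_zero]
    ext p
    rw [analyticSubalgebra.aeval_apply]
    have hval : (fun j ↦ (![b i, a i] j).1 p) = ![φ (L i p), μ (L i p)] := by
      ext j; fin_cases j <;> rfl
    rw [hval]
    exact hH _ (hεS p.2 i).2 (hεS p.2 i).1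
  have ha_dep : ¬ AlgebraicIndependent ℂ a := by
    refine fun h ↦ hG (algebraicIndependent_iff.1 h G ?_)
    ext p
    rw [analyticSubalgebra.aeval_apply]
    change MvPolynomial.eval (fun i ↦ μ (L i p)) G = 0
    rw [hL]
    exact hAAT _ _ (hεS p.2 0).1 (hεS p.2 1).1 (hεS p.2 2).1
  have hb_dep : ¬ AlgebraicIndependent ℂ b := fun h ↦ ha_dep <| .of_forall_mem_closure
    (fun i ↦ AlgebraicIndependent.mem_closure_singleton_of_not_pair (ha i) (hba i)) h
  obtain ⟨g, hgb, hg⟩ : ∃ g, MvPolynomial.aeval b g = 0 ∧ g ≠ 0 := by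
    simpa [algebraicIndependent_iff] using hb_dep
  refine ⟨g, hg, fun u v hu hv ↦ ?_⟩
  have hgan : AnalyticOnNhd ℂ (fun p ↦ MvPolynomial.eval (fun i ↦ φ (L i p)) g)
      (ball (0 : ℂ) (r / 2) ×ˢ ball (0 : ℂ) (r / 2)) := fun p hp ↦
    AnalyticAt.aeval_mvPolynomial (fun i ↦ (hφ _ (hLball hp i)).comp ((L i).analyticAt p)) g
  have hzero := hgan.eqOn_zero_of_preconnected_of_eventuallyEq_zero
    ((convex_ball _ _).prod (convex_ball _ _)).isPreconnected (z₀ := (t, t)) ⟨htr, htr⟩ (by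
      filter_upwards [ball_mem_nhds (t, t) hε] with p hp
      have h := congrFun (congrArg Subtype.val hgb) ⟨p, hp⟩
      rwa [analyticSubalgebra.aeval_apply] at h)
    (show (u, v) ∈ _ from ⟨mem_ball_zero_iff.2 hu, mem_ball_zero_iff.2 hv⟩)
  rw [← hL φ (u, v)]
  exact hzero
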